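/- There is no tuple (c_1, …, c_10) ∈ 𝔽_7¹⁰ such that the polynomial f(x) = c_1x + c_2x² + ⋯ + c_{10}x¹⁰ + x¹¹ ∈ 𝔽_7[x] is squarefree and the 5×5 matrix A with entries a_{ij} = κ_{7i−j}, where f(x)³ = Σ_m κ_m x^m, has rank 1. (Equivalently: no genus 5 hyperelliptic curve over 𝔽_7 with a defining polynomial of this form has a-number 4.) -/

import Mathlib

open Polynomial

namespace CM

def all7 (p : ℕ → Bool) : Bool := p 0 && p 1 && p 2 && p 3 && p 4 && p 5 && p 6

theorem all7_spec {p : ℕ → Bool} (h : all7 p = true) {n : ℕ} (hn : n < 7) : p n = true := by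
  simp only [all7, Bool.and_eq_true] at h
  obtain ⟨⟨⟨⟨⟨⟨h0, h1⟩, h2⟩, h3⟩, h4⟩, h5⟩, h6⟩ := h
  interval_cases n <;> assumption

def any7 (p : ℕ → Bool) : Bool := p 0 || p 1 || p 2 || p 3 || p 4 || p 5 || p 6

theorem any7_spec {p : ℕ → Bool} (h : any7 p = true) : ∃ n, p n = true := by
  simp only [any7, Bool.or_eq_true] at h
  rcases h with ((((((h | h) | h) | h) | h) | h) | h) <;> exact ⟨_, h⟩

/-- Polynomials as coefficient lists (natural representatives mod 7). -/
noncomputable def toP : List ℕ → (ZMod 7)[X]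
  | [] => 0
  | a :: l => C (a : ZMod 7) + X * toP l

def addL : List ℕ → List ℕ → List ℕ
  | [], b => b
  | a :: as, [] => a :: as
  | a :: as, b :: bs => Nat.add a b :: addL as bs

def scaleL (a : ℕ) : List ℕ → List ℕ
  | [] => []
  | b :: bs => Nat.mul a b :: scaleL a bs

def mulL : List ℕ → List ℕ → List ℕ
  | [], _ => []
  | a :: as, b => addL (scaleL a b) (0 :: mulL as b)

theorem toP_add (a b : List ℕ) : toP (addL a b) = toP a + toP b := by
  induction a generalizing b with
  | nil => simp [addL, toP]
  | cons a as ih =>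
    cases b with
    | nil => simp [addL, toP]
    | cons b bs =>
      have : (Nat.add a b) = a + b := rfl
      simp only [addL, toP, ih, this, Nat.cast_add, C_add]; ring

theorem toP_scale (a : ℕ) (b : List ℕ) : toP (scaleL a b) = C (a : ZMod 7) * toP b := by
  induction b with
  | nil => simp [scaleL, toP]
  | cons b bs ih =>
    have : (Nat.mul a b) = a * b := rfl
    simp only [scaleL, toP, ih, this, Nat.cast_mul, C_mul]; ring

theorem toP_mul (a b : List ℕ) : toP (mulL a b) = toP a * toP b := by
  induction a with
  | nil => simp [mulL, toP]
  | cons a as ih =>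
    simp only [mulL, toP, toP_add, toP_scale, ih, Nat.cast_zero, C_0]; ring

def nth : List ℕ → ℕ → ℕ
  | [], _ => 0
  | a :: _, 0 => a
  | _ :: l, n + 1 => nth l n

theorem coeff_toP (l : List ℕ) (m : ℕ) : (toP l).coeff m = (nth l m : ZMod 7) := by
  induction l generalizing m with
  | nil => simp [toP, nth]
  | cons a l ih =>
    cases m with
    | zero => simp [toP, nth]
    | succ m => simp [toP, nth, ih]

def cube (l : List ℕ) : List ℕ := mulL l (mulL l l)

theorem toP_cube (l : List ℕ) : toP (cube l) = toP l ^ 3 := by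
  simp only [cube, toP_mul]; ring

/-- equality mod 7 of coefficient lists -/
def eqL : List ℕ → List ℕ → Bool
  | [], [] => true
  | a :: as, b :: bs => Nat.beq (Nat.mod a 7) (Nat.mod b 7) && eqL as bs
  | _, _ => false

theorem eqL_spec (a b : List ℕ) (h : eqL a b = true) : toP a = toP b := by
  induction a generalizing b with
  | nil => cases b with
    | nil => rfl
    | cons b bs => simp [eqL] at h
  | cons a as ih => cases b with
    | nil => simp [eqL] at h
    | cons b bs =>
      simp only [eqL, Bool.and_eq_true] at h
      have h1 : a % 7 = b % 7 := Nat.eq_of_beq_eq_true h.1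
      have h2 : (a : ZMod 7) = b := (ZMod.natCast_eq_natCast_iff' a b 7).2 h1
      simp only [toP, h2, ih bs h.2]

/-- reduce mod 7 the list `as + c * t` (lengths: that of `as`). -/
def subL (c : ℕ) : List ℕ → List ℕ → List ℕ
  | a :: as, t :: ts => Nat.mod (a.add (c.mul t)) 7 :: subL c as ts
  | as, _ => as

/-- quotient by a monic polynomial, high coefficients first; `t` is the tail of the divisor -/
def quo : ℕ → List ℕ → List ℕ → List ℕ
  | 0, _, _ => []
  | n + 1, l, t => match l with
    | [] => []
    | a :: as => Nat.mod a 7 :: quo n (subL (Nat.mul 6 a) as t) t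

def rev : List ℕ → List ℕ → List ℕ
  | [], acc => acc
  | a :: as, acc => rev as (a :: acc)

def sqTest (l q : List ℕ) (n : ℕ) : Bool :=
  eqL l (mulL (mulL q q) (rev (quo n (rev l []) ((rev (mulL q q) []).tail)) []))

def nonsq (l : List ℕ) : Bool :=
  any7 (fun r => sqTest l [r, 1] 10) ||
  any7 (fun r => any7 (fun s => sqTest l [r, s, 1] 8))

theorem sqTest_spec (l q : List ℕ) (n : ℕ) (h : sqTest l q n = true) : toP q * toP q ∣ toP l := by
  rw [eqL_spec _ _ h, toP_mul, toP_mul]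
  exact Dvd.intro _ rfl

theorem fact7 : Fact (Nat.Prime 7) := ⟨by norm_num⟩

theorem nonsq_spec (l : List ℕ) (h : nonsq l = true) : ¬ Squarefree (toP l) := by
  have := fact7
  intro hs
  simp only [nonsq, Bool.or_eq_true] at h
  rcases h with h | h
  · obtain ⟨r, h⟩ := any7_spec h
    have := Polynomial.natDegree_eq_zero_of_isUnit (hs _ (sqTest_spec _ _ _ h))
    have h1 : (toP [r, 1]).coeff 1 = 0 := Polynomial.coeff_eq_zero_of_natDegree_lt (by omega)
    rw [coeff_toP] at h1
    simp only [nth, Nat.cast_one] at h1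
    exact one_ne_zero h1
  · obtain ⟨r, h⟩ := any7_spec h
    obtain ⟨s, h⟩ := any7_spec h
    have := Polynomial.natDegree_eq_zero_of_isUnit (hs _ (sqTest_spec _ _ _ h))
    have h1 : (toP [r, s, 1]).coeff 2 = 0 := Polynomial.coeff_eq_zero_of_natDegree_lt (by omega)
    rw [coeff_toP] at h1
    simp only [nth, Nat.cast_one] at h1
    exact one_ne_zero h1

def eq7 (a b : ℕ) : Bool := Nat.beq (Nat.mod a 7) (Nat.mod b 7)

notation:70 a:70 "⊗ₙ" b:71 => Nat.mul a b
notation:65 a:65 "⊕ₙ" b:66 => Nat.add a b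

def k4 (c1 c2 : ℕ) : ℕ := 3 ⊗ₙ c1 ⊗ₙ c1 ⊗ₙ c2
def k5 (c1 c2 c3 : ℕ) : ℕ := 3 ⊗ₙ c1 ⊗ₙ c1 ⊗ₙ c3 ⊕ₙ 3 ⊗ₙ c1 ⊗ₙ c2 ⊗ₙ c2
def k6 (c1 c2 c3 c4 : ℕ) : ℕ := 3 ⊗ₙ c1 ⊗ₙ c1 ⊗ₙ c4 ⊕ₙ (6 ⊗ₙ c1 ⊗ₙ c2 ⊗ₙ c3 ⊕ₙ c2 ⊗ₙ c2 ⊗ₙ c2)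
def k9 (c1 c2 c3 c4 c5 c6 c7 : ℕ) : ℕ :=
  (3 ⊗ₙ c1 ⊗ₙ c1 ⊗ₙ c7 ⊕ₙ 6 ⊗ₙ c1 ⊗ₙ c2 ⊗ₙ c6 ⊕ₙ 3 ⊗ₙ c1 ⊗ₙ c4 ⊗ₙ c4 ⊕ₙ 6 ⊗ₙ c2 ⊗ₙ c3 ⊗ₙ c4 ⊕ₙ c3 ⊗ₙ c3 ⊗ₙ c3)
    ⊕ₙ (6 ⊗ₙ c1 ⊗ₙ c3 ⊕ₙ 3 ⊗ₙ c2 ⊗ₙ c2) ⊗ₙ c5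
def k31 (c10 c9 : ℕ) : ℕ := 3 ⊗ₙ c9 ⊕ₙ 3 ⊗ₙ c10 ⊗ₙ c10
def k30 (c10 c9 c8 : ℕ) : ℕ := 3 ⊗ₙ c8 ⊕ₙ (6 ⊗ₙ c10 ⊗ₙ c9 ⊕ₙ c10 ⊗ₙ c10 ⊗ₙ c10)
def k27 (c10 c9 c8 c7 c6 c5 : ℕ) : ℕ :=
  3 ⊗ₙ c5 ⊕ₙ (6 ⊗ₙ c10 ⊗ₙ c6 ⊕ₙ ((6 ⊗ₙ c9 ⊕ₙ 3 ⊗ₙ c10 ⊗ₙ c10) ⊗ₙ c7 ⊕ₙ (3 ⊗ₙ c8 ⊗ₙ c8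
    ⊕ₙ 6 ⊗ₙ c10 ⊗ₙ c9 ⊗ₙ c8 ⊕ₙ c9 ⊗ₙ c9 ⊗ₙ c9)))
def k16 (c1 c2 c3 c4 c5 c6 c7 c8 c9 c10 : ℕ) : ℕ :=
  6 ⊗ₙ c1 ⊗ₙ c4 ⊕ₙ 6 ⊗ₙ c1 ⊗ₙ c5 ⊗ₙ c10 ⊕ₙ 6 ⊗ₙ c1 ⊗ₙ c6 ⊗ₙ c9 ⊕ₙ 6 ⊗ₙ c1 ⊗ₙ c7 ⊗ₙ c8
    ⊕ₙ 6 ⊗ₙ c2 ⊗ₙ c3 ⊕ₙ 6 ⊗ₙ c2 ⊗ₙ c4 ⊗ₙ c10 ⊕ₙ 6 ⊗ₙ c2 ⊗ₙ c5 ⊗ₙ c9 ⊕ₙ 6 ⊗ₙ c2 ⊗ₙ c6 ⊗ₙ c8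
    ⊕ₙ 3 ⊗ₙ c2 ⊗ₙ c7 ⊗ₙ c7 ⊕ₙ 3 ⊗ₙ c3 ⊗ₙ c3 ⊗ₙ c10 ⊕ₙ 6 ⊗ₙ c3 ⊗ₙ c4 ⊗ₙ c9 ⊕ₙ 6 ⊗ₙ c3 ⊗ₙ c5 ⊗ₙ c8
    ⊕ₙ 6 ⊗ₙ c3 ⊗ₙ c6 ⊗ₙ c7 ⊕ₙ 3 ⊗ₙ c4 ⊗ₙ c4 ⊗ₙ c8 ⊕ₙ 6 ⊗ₙ c4 ⊗ₙ c5 ⊗ₙ c7 ⊕ₙ 3 ⊗ₙ c4 ⊗ₙ c6 ⊗ₙ c6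
    ⊕ₙ 3 ⊗ₙ c5 ⊗ₙ c5 ⊗ₙ c6
def k23 (c1 c2 c3 c4 c5 c6 c7 c8 c9 c10 : ℕ) : ℕ :=
  3 ⊗ₙ c1 ⊕ₙ 6 ⊗ₙ c2 ⊗ₙ c10 ⊕ₙ 6 ⊗ₙ c3 ⊗ₙ c9 ⊕ₙ 3 ⊗ₙ c3 ⊗ₙ c10 ⊗ₙ c10
    ⊕ₙ 6 ⊗ₙ c4 ⊗ₙ c8 ⊕ₙ 6 ⊗ₙ c4 ⊗ₙ c9 ⊗ₙ c10 ⊕ₙ 6 ⊗ₙ c5 ⊗ₙ c7 ⊕ₙ 6 ⊗ₙ c5 ⊗ₙ c8 ⊗ₙ c10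
    ⊕ₙ 3 ⊗ₙ c5 ⊗ₙ c9 ⊗ₙ c9 ⊕ₙ 3 ⊗ₙ c6 ⊗ₙ c6 ⊕ₙ 6 ⊗ₙ c6 ⊗ₙ c7 ⊗ₙ c10 ⊕ₙ 6 ⊗ₙ c6 ⊗ₙ c8 ⊗ₙ c9
    ⊕ₙ 3 ⊗ₙ c7 ⊗ₙ c7 ⊗ₙ c9 ⊕ₙ 3 ⊗ₙ c7 ⊗ₙ c8 ⊗ₙ c8

def rowTest (L : List ℕ) (m : ℕ) : Bool :=
  eq7 (nth L (m + 4)) 0 && eq7 (nth L m) 0 &&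
  eq7 (nth L (m + 2)) (nth L (m + 3) ⊗ₙ nth L 32) &&
  eq7 (nth L (m + 1)) (nth L (m + 3) ⊗ₙ nth L 31)

def leaf (l : List ℕ) : Bool :=
  !(rowTest (cube l) 9 && rowTest (cube l) 16 && rowTest (cube l) 23) || nonsq l

def search : Bool :=
  all7 fun c1 => eq7 c1 0 ||
  all7 fun c2 => all7 fun c3 => all7 fun c4 => !(eq7 (k6 c1 c2 c3 c4) 0) ||
  all7 fun c10 => !(eq7 (k4 c1 c2) (k5 c1 c2 c3 ⊗ₙ (3 ⊗ₙ c10))) ||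
  all7 fun c9 => !(eq7 (c1 ⊗ₙ c1 ⊗ₙ c1) (k5 c1 c2 c3 ⊗ₙ k31 c10 c9)) ||
  all7 fun c8 => !(eq7 (k30 c10 c9 c8) 0) ||
  all7 fun c7 => all7 fun c6 => all7 fun c5 => !(eq7 (k27 c10 c9 c8 c7 c6 c5) 0) ||
    !(eq7 (k9 c1 c2 c3 c4 c5 c6 c7) 0) || !(eq7 (k16 c1 c2 c3 c4 c5 c6 c7 c8 c9 c10) 0) ||
    !(eq7 (k23 c1 c2 c3 c4 c5 c6 c7 c8 c9 c10) 0) ||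
    leaf [0, c1, c2, c3, c4, c5, c6, c7, c8, c9, c10, 1]

set_option maxRecDepth 100000 in
theorem search_true : search = true := by decide +kernel


theorem eq7_of {a b : ℕ} (h : (a : ZMod 7) = b) : eq7 a b = true := by
  have h' : a % 7 = b % 7 := (ZMod.natCast_eq_natCast_iff' a b 7).1 h
  change Nat.beq (a % 7) (b % 7) = true
  rw [h']
  exact Nat.beq_refl _

theorem minor {A : Matrix (Fin 5) (Fin 5) (ZMod 7)} (h : A.rank = 1) (i j k l : Fin 5) :
    A i j * A k l = A i l * A k j := by
  have := fact7
  rw [Matrix.rank_eq_finrank_span_cols] at h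
  obtain ⟨v, hv⟩ := finrank_le_one_iff.1 h.le
  have key : ∀ j, ∃ c : ZMod 7, ∀ i, A i j = c * v.1 i := by
    intro j
    obtain ⟨c, hc⟩ := hv ⟨A.col j, Submodule.subset_span ⟨j, rfl⟩⟩
    refine ⟨c, fun i => ?_⟩
    have := congrFun (congrArg Subtype.val hc) i
    exact this.symm
  obtain ⟨c, hc⟩ := key j
  obtain ⟨d, hd⟩ := key l
  rw [hc, hc, hd, hd]; ring

set_option maxHeartbeats 4000000 in
theorem final (c1 c2 c3 c4 c5 c6 c7 c8 c9 c10 : ℕ)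
    (h1 : c1 < 7) (h2 : c2 < 7) (h3 : c3 < 7) (h4 : c4 < 7) (h5 : c5 < 7)
    (h6 : c6 < 7) (h7 : c7 < 7) (h8 : c8 < 7) (h9 : c9 < 7) (h10 : c10 < 7)
    (l : List ℕ) (hl : l = [0, c1, c2, c3, c4, c5, c6, c7, c8, c9, c10, 1])
    (hT : ∀ i j : Fin 5, (nth (cube l) (7 * ((i : ℕ) + 1) - ((j : ℕ) + 1)) : ZMod 7)
      = nth (cube l) (7 * ((i : ℕ) + 1) - 2) * nth (cube l) (35 - ((j : ℕ) + 1)))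
    (hs : Squarefree (toP l)) : False := by
  have := fact7
  have e2 : nth (cube l) 2 = 0 := by subst hl; simp [cube, mulL, addL, scaleL, nth]
  have e3 : nth (cube l) 3 = c1 ⊗ₙ c1 ⊗ₙ c1 := by
    subst hl; simp [cube, mulL, addL, scaleL, nth]; ring
  have e4 : nth (cube l) 4 = k4 c1 c2 := by
    subst hl; simp [cube, mulL, addL, scaleL, nth, k4]; ring
  have e5 : nth (cube l) 5 = k5 c1 c2 c3 := by
    subst hl; simp [cube, mulL, addL, scaleL, nth, k5]; ring
  have e6 : nth (cube l) 6 = k6 c1 c2 c3 c4 := by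
    subst hl; simp [cube, mulL, addL, scaleL, nth, k6]; ring
  have e9 : nth (cube l) 9 = k9 c1 c2 c3 c4 c5 c6 c7 := by
    subst hl; simp [cube, mulL, addL, scaleL, nth, k9]; ring
  have e16 : nth (cube l) 16 = k16 c1 c2 c3 c4 c5 c6 c7 c8 c9 c10 := by
    subst hl; simp [cube, mulL, addL, scaleL, nth, k16]; ring
  have e23 : nth (cube l) 23 = k23 c1 c2 c3 c4 c5 c6 c7 c8 c9 c10 := by
    subst hl; simp [cube, mulL, addL, scaleL, nth, k23]; ring
  have e27 : nth (cube l) 27 = k27 c10 c9 c8 c7 c6 c5 := by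
    subst hl; simp [cube, mulL, addL, scaleL, nth, k27]; ring
  have e30 : nth (cube l) 30 = k30 c10 c9 c8 := by
    subst hl; simp [cube, mulL, addL, scaleL, nth, k30]; ring
  have e31 : nth (cube l) 31 = k31 c10 c9 := by
    subst hl; simp [cube, mulL, addL, scaleL, nth, k31]; ring
  have e32 : nth (cube l) 32 = 3 ⊗ₙ c10 := by
    subst hl; simp [cube, mulL, addL, scaleL, nth]; ring
  have e34 : nth (cube l) 34 = 0 := by subst hl; simp [cube, mulL, addL, scaleL, nth]
  have hc1 : ¬ (c1 : ZMod 7) = 0 := by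
    intro h
    have h0 : c1 = 0 := by
      have := (ZMod.natCast_eq_zero_iff c1 7).1 h
      omega
    have hd : X * X ∣ toP l := by
      subst hl
      simp only [toP, h0, Nat.cast_zero, C_0, zero_add]
      rw [← mul_assoc]
      exact Dvd.intro _ rfl
    exact Polynomial.not_isUnit_X (hs _ hd)
  -- the equations
  have hcol : ∀ i : Fin 5, (nth (cube l) (7 * ((i : ℕ) + 1) - 1) : ZMod 7) = 0 := by
    intro i
    have := hT i 0
    simpa [e34] using this
  have t6 := hcol 0
  have t13 := hcol 1
  have t20 := hcol 2
  have t27 := hcol 3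
  have r4 := hT 0 2
  have r3 := hT 0 3
  have r2 := hT 0 4
  have a11 := hT 1 2
  have a10 := hT 1 3
  have a9 := hT 1 4
  have b18 := hT 2 2
  have b17 := hT 2 3
  have b16 := hT 2 4
  have d25 := hT 3 2
  have d24 := hT 3 3
  have d23 := hT 3 4
  norm_num at t6 t13 t20 t27 r4 r3 r2 a11 a10 a9 b18 b17 b16 d25 d24 d23
  have k30z : (nth (cube l) 30 : ZMod 7) = 0 := by
    rw [e2, Nat.cast_zero] at r2
    rcases mul_eq_zero.1 r2.symm with h | h
    · exfalso
      rw [h, zero_mul, e3] at r3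
      simp at r3
      exact hc1 r3
    · exact h
  rw [k30z, mul_zero] at a9 b16 d23
  have ez : ∀ m, (nth (cube l) m : ZMod 7) = 0 → eq7 (nth (cube l) m) 0 = true :=
    fun m h => eq7_of (by simpa using h)
  have em : ∀ m n k, (nth (cube l) m : ZMod 7) = nth (cube l) n * nth (cube l) k →
      eq7 (nth (cube l) m) (nth (cube l) n ⊗ₙ nth (cube l) k) = true :=
    fun m n k h => eq7_of (by simpa using h)
  have row9 : rowTest (cube l) 9 = true := by
    simp only [rowTest, Bool.and_eq_true]
    exact ⟨⟨⟨ez _ t13, ez _ a9⟩, em _ _ _ a11⟩, em _ _ _ a10⟩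
  have row16 : rowTest (cube l) 16 = true := by
    simp only [rowTest, Bool.and_eq_true]
    exact ⟨⟨⟨ez _ t20, ez _ b16⟩, em _ _ _ b18⟩, em _ _ _ b17⟩
  have row23 : rowTest (cube l) 23 = true := by
    simp only [rowTest, Bool.and_eq_true]
    exact ⟨⟨⟨ez _ t27, ez _ d23⟩, em _ _ _ d25⟩, em _ _ _ d24⟩
  have c1f : eq7 c1 0 = false := by
    rw [Bool.eq_false_iff]
    intro h
    have h' : c1 % 7 = 0 % 7 := Nat.eq_of_beq_eq_true h
    exact hc1 (by simpa using (ZMod.natCast_eq_natCast_iff' c1 0 7).2 h')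
  have T6 := ez _ t6
  have T27 := ez _ t27
  have T9 := ez _ a9
  have T30 := ez _ k30z
  have T4 := em _ _ _ r4
  have T3 := em _ _ _ r3
  have T16 := ez _ b16
  have T23 := ez _ d23
  rw [e16] at T16
  rw [e23] at T23
  rw [e6] at T6
  rw [e27] at T27
  rw [e9] at T9
  rw [e30] at T30
  rw [e4, e5, e32] at T4
  rw [e3, e5, e31] at T3
  have H := all7_spec search_true h1
  rw [c1f, Bool.false_or] at H
  have H := all7_spec (all7_spec (all7_spec H h2) h3) h4
  rw [T6, Bool.not_true, Bool.false_or] at H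
  have H := all7_spec H h10
  rw [T4, Bool.not_true, Bool.false_or] at H
  have H := all7_spec H h9
  rw [T3, Bool.not_true, Bool.false_or] at H
  have H := all7_spec H h8
  rw [T30, Bool.not_true, Bool.false_or] at H
  have H := all7_spec (all7_spec (all7_spec H h7) h6) h5
  rw [T27, T9, T16, T23, Bool.not_true, Bool.false_or, Bool.false_or, Bool.false_or,
    Bool.false_or, ← hl] at H
  rw [leaf, row9, row16, row23] at H
  exact nonsq_spec l (by simpa using H) hs

end CM

/-- No tuple `(c_1, …, c_10) ∈ 𝔽_7¹⁰` makes `f = Σ c_i x^i + x^11` squarefree with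
Cartier–Manin matrix of rank one (genus 5, `p = 7`). -/
theorem no_rank_one_genus5_over_F7 :
    ¬ ∃ (c : Fin 10 → ZMod 7) (f : (ZMod 7)[X]) (A : Matrix (Fin 5) (Fin 5) (ZMod 7)),
      f = (∑ i : Fin 10, C (c i) * X ^ ((i : ℕ) + 1)) + X ^ 11 ∧
      (∀ i j : Fin 5,
        A i j = (f ^ 3).coeff (7 * ((i : ℕ) + 1) - ((j : ℕ) + 1))) ∧
      Squarefree f ∧ A.rank = 1 := by
  rintro ⟨c, f, A, hf, hA, hs, hr⟩
  have hlt : ∀ i, (c i).val < 7 := fun i => ZMod.val_lt _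
  have hc : ∀ i, (((c i).val : ℕ) : ZMod 7) = c i := fun i => ZMod.natCast_zmod_val _
  obtain ⟨l, hl⟩ : ∃ l, l = [0, (c 0).val, (c 1).val, (c 2).val, (c 3).val, (c 4).val,
    (c 5).val, (c 6).val, (c 7).val, (c 8).val, (c 9).val, 1] := ⟨_, rfl⟩
  have hfl : f = CM.toP l := by
    rw [hf, hl]
    simp only [CM.toP, hc, Fin.sum_univ_succ, Nat.cast_zero, Nat.cast_one, C_0, C_1]
    simp
    ring
  rw [hfl] at hs
  have hA' : ∀ i j : Fin 5,
      A i j = (CM.nth (CM.cube l) (7 * ((i : ℕ) + 1) - ((j : ℕ) + 1)) : ZMod 7) := by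
    intro i j
    rw [hA, hfl, ← CM.toP_cube, CM.coeff_toP]
  have e33 : CM.nth (CM.cube l) 33 = 1 := by
    subst hl; simp [CM.cube, CM.mulL, CM.addL, CM.scaleL, CM.nth]
  refine CM.final _ _ _ _ _ _ _ _ _ _ (hlt 0) (hlt 1) (hlt 2) (hlt 3) (hlt 4) (hlt 5)
    (hlt 6) (hlt 7) (hlt 8) (hlt 9) l hl ?_ hs
  intro i j
  have h41 : A 4 1 = 1 := by
    rw [hA']
    exact (congrArg (Nat.cast : ℕ → ZMod 7) e33).trans Nat.cast_one
  have := CM.minor hr i j 4 1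
  rw [h41, mul_one, hA', hA' i 1, hA' 4 j] at this
  exact this
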